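/- arXiv:1110.5202 — 2 statements merged into one kernel-verified Lean document; each statement's English description precedes it below -/
import Mathlib

section
/- Let T > 0, let (πₙ) be a sequence of partitions of [0,T] with mesh |πₙ| → 0, and let x : [0,T] → ℝ be a continuous path having quadratic variation q along (πₙ). Let f : [0,T] × ℝ → ℝ be continuously differentiable in the time variable and twice continuously differentiable in the space variable, with all these partial derivatives jointly continuous. Then the limit I := lim_{n→∞} Σ_{t_j^n ∈ πₙ ∩ (0,T]} ∂_x f(t_{j−1}^n, x(t_{j−1}^n)) (x(t_j^n) − x(t_{j−1}^n)) exists (the Föllmer integral of ∂_x f(·, x(·)) against x), and the change of variables formula holds: f(T, x(T)) = f(0, x(0)) + ∫₀^T ∂_t f(s, x(s)) ds + (1/2) ∫_{(0,T]} ∂²_{xx} f(s, x(s)) dμ_q(s) + I. -/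
open Filter MeasureTheory Set

/-- A sequence of partitions of `[0, T]` with mesh tending to `0`.
For each `n`, the partition is `0 = τ n 0 < τ n 1 < ⋯ < τ n (k n) = T`. -/
structure PartitionSeq (T : ℝ) where
  k : ℕ → ℕ
  τ : ℕ → ℕ → ℝ
  k_pos : ∀ n, 0 < k n
  first : ∀ n, τ n 0 = 0
  last : ∀ n, τ n (k n) = T
  mono : ∀ n, StrictMonoOn (τ n) (Set.Iic (k n))
  mesh : ∀ ε > 0, ∃ N, ∀ n ≥ N, ∀ j < k n, τ n (j + 1) - τ n j < ε

/-- Forward Riemann sum of `y` against `x` along the partition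
`τ 0 < τ 1 < ⋯ < τ k`, up to time `t`:
`Σ_{τ (j+1) ≤ t} y (τ j) * (x (τ (j+1)) - x (τ j))`. -/
noncomputable def fwdSum (k : ℕ) (τ : ℕ → ℝ) (y x : ℝ → ℝ) (t : ℝ) : ℝ :=
  ∑ j ∈ Finset.range k, if τ (j + 1) ≤ t then y (τ j) * (x (τ (j + 1)) - x (τ j)) else 0

/-- Quadratic variation sum of the path `x` along the partition
`τ 0 < τ 1 < ⋯ < τ k`, up to time `t`. -/
noncomputable def quadSum (k : ℕ) (τ : ℕ → ℝ) (x : ℝ → ℝ) (t : ℝ) : ℝ :=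
  ∑ j ∈ Finset.range k, if τ (j + 1) ≤ t then (x (τ (j + 1)) - x (τ j)) ^ 2 else 0

namespace PartitionSeq

variable {T : ℝ} (P : PartitionSeq T)

theorem le_of_le {n i j : ℕ} (hij : i ≤ j) (hj : j ≤ P.k n) : P.τ n i ≤ P.τ n j :=
  (P.mono n).monotoneOn (mem_Iic.2 (hij.trans hj)) (mem_Iic.2 hj) hij

theorem mem_Icc {n j : ℕ} (hj : j ≤ P.k n) : P.τ n j ∈ Icc (0 : ℝ) T :=
  ⟨(P.first n).symm.trans_le (P.le_of_le (Nat.zero_le j) hj),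
    (P.le_of_le hj le_rfl).trans_eq (P.last n)⟩

theorem eventually_abs_sub_lt {δ : ℝ} (hδ : 0 < δ) :
    ∀ᶠ n in atTop, ∀ j < P.k n, ∀ s ∈ Icc (P.τ n j) (P.τ n (j + 1)),
      ∀ t ∈ Icc (P.τ n j) (P.τ n (j + 1)), |s - t| < δ := by
  obtain ⟨N, hN⟩ := P.mesh δ hδ
  filter_upwards [eventually_ge_atTop N] with n hn j hj s hs t ht
  have := hN n hn j hj
  rw [abs_sub_lt_iff]
  constructor <;> linarith [hs.1, hs.2, ht.1, ht.2]

theorem exists_mem_Ioc (n : ℕ) {t : ℝ} (ht : t ∈ Ioc (0 : ℝ) T) :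
    ∃ i < P.k n, t ∈ Ioc (P.τ n i) (P.τ n (i + 1)) := by
  by_contra! h
  have key : ∀ i ≤ P.k n, P.τ n i < t := by
    intro i
    induction i with
    | zero => intro _; rw [P.first]; exact ht.1
    | succ i ih =>
      intro hi
      by_contra hlt
      exact h i hi ⟨ih (Nat.le_of_succ_le hi), not_lt.1 hlt⟩
  exact absurd (key _ le_rfl) (by rw [P.last]; exact not_lt.2 ht.2)

/-- Evaluation at `t` of the left-continuous step function with value `g (τ i)` on
`(τ i, τ (i + 1)]`. -/
theorem sum_step_eq (n : ℕ) (g : ℝ → ℝ) {t : ℝ} {i : ℕ} (hi : i < P.k n)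
    (ht : t ∈ Ioc (P.τ n i) (P.τ n (i + 1))) :
    ∑ l ∈ Finset.range (P.k n), g (P.τ n l) *
      ((if t ≤ P.τ n (l + 1) then 1 else 0) - (if t ≤ P.τ n l then 1 else 0)) = g (P.τ n i) := by
  rw [Finset.sum_eq_single i]
  · rw [if_pos ht.2, if_neg (not_le.2 ht.1)]; ring
  · intro l hl hne
    have hl := Finset.mem_range.1 hl
    rcases lt_or_gt_of_ne hne with h | h
    · have h1 : P.τ n (l + 1) < t := (P.le_of_le h hi.le).trans_lt ht.1
      have h2 : P.τ n l < t := (P.le_of_le h.le hi.le).trans_lt ht.1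
      rw [if_neg (not_le.2 h1), if_neg (not_le.2 h2)]; ring
    · have h1 : t ≤ P.τ n l := ht.2.trans (P.le_of_le h hl.le)
      have h2 : t ≤ P.τ n (l + 1) := h1.trans (P.le_of_le (Nat.le_succ l) hl)
      rw [if_pos h1, if_pos h2]; ring
  · intro h; exact absurd (Finset.mem_range.2 hi) h

/-- The weighted sum against a continuous function is close to the one against the step function
of the partition `m`, written through the cumulative sums of the weights. -/
theorem abs_sum_sub_step_le {n m : ℕ} {g : ℝ → ℝ} {δ ε : ℝ}
    (hg : ∀ s ∈ Icc (0 : ℝ) T, ∀ t ∈ Icc (0 : ℝ) T, |s - t| < 2 * δ → |g s - g t| ≤ ε)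
    (hn : ∀ j < P.k n, ∀ s ∈ Icc (P.τ n j) (P.τ n (j + 1)),
      ∀ t ∈ Icc (P.τ n j) (P.τ n (j + 1)), |s - t| < δ)
    (hm : ∀ j < P.k m, ∀ s ∈ Icc (P.τ m j) (P.τ m (j + 1)),
      ∀ t ∈ Icc (P.τ m j) (P.τ m (j + 1)), |s - t| < δ)
    {w : ℕ → ℝ} (hw : ∀ j, 0 ≤ w j) :
    |∑ j ∈ Finset.range (P.k n), g (P.τ n j) * w j -
      ∑ i ∈ Finset.range (P.k m), g (P.τ m i) *
        ((∑ j ∈ Finset.range (P.k n), if P.τ n (j + 1) ≤ P.τ m (i + 1) then w j else 0) -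
          ∑ j ∈ Finset.range (P.k n), if P.τ n (j + 1) ≤ P.τ m i then w j else 0)| ≤
      ε * ∑ j ∈ Finset.range (P.k n), w j := by
  have hswap : ∑ i ∈ Finset.range (P.k m), g (P.τ m i) *
        ((∑ j ∈ Finset.range (P.k n), if P.τ n (j + 1) ≤ P.τ m (i + 1) then w j else 0) -
          ∑ j ∈ Finset.range (P.k n), if P.τ n (j + 1) ≤ P.τ m i then w j else 0) =
      ∑ j ∈ Finset.range (P.k n), (∑ i ∈ Finset.range (P.k m), g (P.τ m i) *
        ((if P.τ n (j + 1) ≤ P.τ m (i + 1) then 1 else 0) -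
          (if P.τ n (j + 1) ≤ P.τ m i then 1 else 0))) * w j := by
    simp_rw [← Finset.sum_sub_distrib, Finset.mul_sum, Finset.sum_mul]
    rw [Finset.sum_comm]
    refine Finset.sum_congr rfl fun j _ => Finset.sum_congr rfl fun i _ => ?_
    split_ifs <;> ring
  rw [hswap, ← Finset.sum_sub_distrib, Finset.mul_sum]
  refine (Finset.abs_sum_le_sum_abs _ _).trans (Finset.sum_le_sum fun j hj => ?_)
  have hj := Finset.mem_range.1 hj
  have hlt : P.τ n j < P.τ n (j + 1) :=
    P.mono n (mem_Iic.2 hj.le) (mem_Iic.2 hj) (Nat.lt_succ_self j)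
  have hmem := P.mem_Icc hj.le
  obtain ⟨i, hi, hti⟩ := P.exists_mem_Ioc m
    (t := P.τ n (j + 1)) ⟨hmem.1.trans_lt hlt, (P.mem_Icc hj).2⟩
  rw [P.sum_step_eq m g hi hti, ← sub_mul, abs_mul, abs_of_nonneg (hw j)]
  refine mul_le_mul_of_nonneg_right (hg _ hmem _ (P.mem_Icc hi.le) ?_) (hw j)
  have h1 := hn j hj _ (left_mem_Icc.2 hlt.le) _ (right_mem_Icc.2 hlt.le)
  have h2 := hm i hi _ (Ioc_subset_Icc_self hti) _ (left_mem_Icc.2 (hti.1.le.trans hti.2))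
  linarith [abs_sub_le (P.τ n j) (P.τ n (j + 1)) (P.τ m i)]

/-- Stieltjes sums along a fine partition approximate the integral. -/
theorem abs_integral_sub_stieltjes_le {m : ℕ} {g : ℝ → ℝ} {δ ε : ℝ}
    {q : ℝ → ℝ} (hq : Monotone q) {μ : Measure ℝ} [IsLocallyFiniteMeasure μ]
    (hμ : ∀ a b : ℝ, a ≤ b → μ (Ioc a b) = ENNReal.ofReal (q b - q a))
    (hgc : ContinuousOn g (Icc 0 T))
    (hg : ∀ s ∈ Icc (0 : ℝ) T, ∀ t ∈ Icc (0 : ℝ) T, |s - t| < 2 * δ → |g s - g t| ≤ ε)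
    (hδ : 0 < δ)
    (hm : ∀ j < P.k m, ∀ s ∈ Icc (P.τ m j) (P.τ m (j + 1)),
      ∀ t ∈ Icc (P.τ m j) (P.τ m (j + 1)), |s - t| < δ) :
    |∑ i ∈ Finset.range (P.k m), g (P.τ m i) * (q (P.τ m (i + 1)) - q (P.τ m i)) -
      ∫ s in Ioc (0 : ℝ) T, g s ∂μ| ≤ ε * (q T - q 0) := by
  have hT : (0 : ℝ) ≤ T := (P.mem_Icc (n := m) le_rfl).1.trans (P.mem_Icc (n := m) le_rfl).2
  have hle : ∀ i < P.k m, P.τ m i ≤ P.τ m (i + 1) := fun i hi => P.le_of_le (Nat.le_succ i) hi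
  have hsub : ∀ i < P.k m, Icc (P.τ m i) (P.τ m (i + 1)) ⊆ Icc 0 T := fun i hi =>
    Icc_subset_Icc (P.mem_Icc hi.le).1 (P.mem_Icc hi).2
  have hint : ∀ i < P.k m, IntervalIntegrable g μ (P.τ m i) (P.τ m (i + 1)) := fun i hi =>
    (hgc.mono (hsub i hi)).intervalIntegrable_of_Icc (hle i hi)
  have hreal : ∀ a b : ℝ, a ≤ b → μ.real (Ioc a b) = q b - q a := fun a b hab => by
    rw [Measure.real, hμ a b hab, ENNReal.toReal_ofReal (sub_nonneg.2 (hq hab))]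
  have htel : q T - q 0 = ∑ i ∈ Finset.range (P.k m), (q (P.τ m (i + 1)) - q (P.τ m i)) := by
    rw [Finset.sum_range_sub (fun i => q (P.τ m i)), P.last, P.first]
  have hsum := intervalIntegral.sum_integral_adjacent_intervals hint
  rw [P.first, P.last] at hsum
  rw [← intervalIntegral.integral_of_le hT, ← hsum, ← Finset.sum_sub_distrib, htel,
    Finset.mul_sum]
  refine (Finset.abs_sum_le_sum_abs _ _).trans (Finset.sum_le_sum fun i hi => ?_)
  have hi := Finset.mem_range.1 hi
  have hconst : g (P.τ m i) * (q (P.τ m (i + 1)) - q (P.τ m i)) =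
      ∫ _ in Ioc (P.τ m i) (P.τ m (i + 1)), g (P.τ m i) ∂μ := by
    rw [setIntegral_const, hreal _ _ (hle i hi), smul_eq_mul, mul_comm]
  have hfin : μ (Ioc (P.τ m i) (P.τ m (i + 1))) < ⊤ := by
    rw [hμ _ _ (hle i hi)]; exact ENNReal.ofReal_lt_top
  have hconst_int : IntegrableOn (fun _ => g (P.τ m i)) (Ioc (P.τ m i) (P.τ m (i + 1))) μ :=
    integrableOn_const hfin.ne
  rw [intervalIntegral.integral_of_le (hle i hi), hconst,
    ← integral_sub hconst_int (hint i hi).1, ← hreal _ _ (hle i hi)]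
  refine (Real.norm_eq_abs _).ge.trans
    (norm_setIntegral_le_of_norm_le_const hfin fun s hs => ?_)
  refine hg _ (P.mem_Icc hi.le) _ (hsub i hi (Ioc_subset_Icc_self hs)) ?_
  linarith [hm i hi _ (left_mem_Icc.2 (hle i hi)) _ (Ioc_subset_Icc_self hs)]

/-- If the cumulative sums of nonnegative weights along the partitions converge pointwise to `q`,
then the weighted sums of a continuous function converge to its integral against `dq`. -/
theorem tendsto_sum_mul_weight {w : ℕ → ℕ → ℝ} (hw : ∀ n j, 0 ≤ w n j)
    {q : ℝ → ℝ} (hq : Monotone q)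
    (hlim : ∀ t ∈ Icc (0 : ℝ) T, Tendsto (fun n => ∑ j ∈ Finset.range (P.k n),
      if P.τ n (j + 1) ≤ t then w n j else 0) atTop (nhds (q t)))
    {μ : Measure ℝ} [IsLocallyFiniteMeasure μ]
    (hμ : ∀ a b : ℝ, a ≤ b → μ (Ioc a b) = ENNReal.ofReal (q b - q a))
    {g : ℝ → ℝ} (hg : ContinuousOn g (Icc 0 T)) :
    Tendsto (fun n => ∑ j ∈ Finset.range (P.k n), g (P.τ n j) * w n j) atTop
      (nhds (∫ s in Ioc (0 : ℝ) T, g s ∂μ)) := by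
  have hT : T ∈ Icc (0 : ℝ) T :=
    right_mem_Icc.2 ((P.mem_Icc (n := 0) le_rfl).1.trans_eq (P.last 0))
  have htot : ∀ᶠ n in atTop, ∑ j ∈ Finset.range (P.k n), w n j < |q T| + 1 := by
    filter_upwards [(hlim T hT).eventually_lt_const
      ((le_abs_self (q T)).trans_lt (lt_add_one _))] with n hn
    refine (Finset.sum_le_sum fun j hj => ?_).trans_lt hn
    rw [if_pos (P.mem_Icc (Finset.mem_range.1 hj)).2]
  rw [Metric.tendsto_nhds]
  intro ε hε
  set C := |q T| + 1 + (q T - q 0) with hC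
  have hC0 : 0 < C := by
    have := hq hT.1
    have := abs_nonneg (q T)
    linarith
  obtain ⟨δ, hδ, hmod⟩ := Metric.uniformContinuousOn_iff.1
    (isCompact_Icc.uniformContinuousOn_of_continuous hg) (ε / 2 / C) (by positivity)
  have hmod' : ∀ s ∈ Icc (0 : ℝ) T, ∀ t ∈ Icc (0 : ℝ) T,
      |s - t| < 2 * (δ / 2) → |g s - g t| ≤ ε / 2 / C := fun s hs t ht hst =>
    (hmod s hs t ht (by rw [Real.dist_eq]; linarith)).le
  obtain ⟨m, hm⟩ := (P.eventually_abs_sub_lt (half_pos hδ)).exists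
  have hstep := tendsto_finsetSum (Finset.range (P.k m)) fun i hi =>
    (((hlim _ (P.mem_Icc (Finset.mem_range.1 hi))).sub
      (hlim _ (P.mem_Icc (Finset.mem_range.1 hi).le))).const_mul (g (P.τ m i)))
  filter_upwards [P.eventually_abs_sub_lt (half_pos hδ), htot,
    Metric.tendsto_nhds.1 hstep (ε / 2) (half_pos hε)] with n hn hQ hH
  have h1 := P.abs_sum_sub_step_le hmod' hn hm (hw n)
  have h2 := P.abs_integral_sub_stieltjes_le hq hμ hg hmod' (half_pos hδ) hm
  have h3 : ε / 2 / C * ∑ j ∈ Finset.range (P.k n), w n j ≤ ε / 2 / C * (|q T| + 1) :=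
    mul_le_mul_of_nonneg_left hQ.le (by positivity)
  have h4 : ε / 2 / C * (|q T| + 1) + ε / 2 / C * (q T - q 0) = ε / 2 := by
    rw [← mul_add, ← hC]; field_simp
  rw [Real.dist_eq] at hH ⊢
  rw [abs_le] at h1 h2
  rw [abs_lt] at hH ⊢
  constructor <;> linarith [h1.1, h1.2, h2.1, h2.2, hH.1, hH.2]

end PartitionSeq

/-- Second-order Taylor estimate in terms of the oscillation of the second derivative. -/
theorem abs_taylor_two_sub_le {φ φ₁ φ₂ : ℝ → ℝ} (h₁ : ∀ c, HasDerivAt φ (φ₁ c) c)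
    (h₂ : ∀ c, HasDerivAt φ₁ (φ₂ c) c) {a b ε : ℝ}
    (hosc : ∀ c ∈ uIcc a b, |φ₂ c - φ₂ a| ≤ ε) :
    |φ b - φ a - φ₁ a * (b - a) - 1 / 2 * (φ₂ a * (b - a) ^ 2)| ≤ ε * (b - a) ^ 2 := by
  have hε : 0 ≤ ε := (abs_nonneg _).trans (hosc a left_mem_uIcc)
  have hfirst : ∀ c ∈ uIcc a b, |φ₁ c - φ₁ a - φ₂ a * (c - a)| ≤ ε * |b - a| := by
    intro c hc
    have hd : ∀ y ∈ uIcc a b, HasDerivWithinAt (fun y => φ₁ y - φ₂ a * y) (φ₂ y - φ₂ a)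
        (uIcc a b) y := fun y _ => by
      simpa using ((h₂ y).fun_sub ((hasDerivAt_id' y).const_mul (φ₂ a))).hasDerivWithinAt
    have := (convex_uIcc a b).norm_image_sub_le_of_norm_hasDerivWithin_le hd hosc
      left_mem_uIcc hc
    rw [Real.norm_eq_abs, Real.norm_eq_abs] at this
    refine (le_of_eq ?_).trans (this.trans
      (mul_le_mul_of_nonneg_left (abs_sub_left_of_mem_uIcc hc) hε))
    congr 1; ring
  have hd : ∀ y ∈ uIcc a b, HasDerivWithinAt
      (fun y => φ y - φ₁ a * y - 1 / 2 * (φ₂ a * (y - a) ^ 2))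
      (φ₁ y - φ₁ a - φ₂ a * (y - a)) (uIcc a b) y := fun y _ => by
    refine HasDerivAt.hasDerivWithinAt ?_
    refine (((h₁ y).fun_sub ((hasDerivAt_id' y).const_mul (φ₁ a))).fun_sub
      (((((hasDerivAt_id' y).sub_const a).fun_pow 2).const_mul (φ₂ a)).const_mul
        (1 / 2))).congr_deriv ?_
    push_cast
    ring
  have := (convex_uIcc a b).norm_image_sub_le_of_norm_hasDerivWithin_le hd hfirst
    left_mem_uIcc right_mem_uIcc
  rw [Real.norm_eq_abs, Real.norm_eq_abs, mul_assoc, abs_mul_abs_self, ← pow_two] at this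
  refine (le_of_eq ?_).trans this
  congr 1; ring

/-- Uniform modulus of continuity of `F` in its second variable around a continuous path. -/
theorem exists_modulus_along_path {T : ℝ} {x : ℝ → ℝ} (hx : ContinuousOn x (Icc 0 T))
    {F : ℝ → ℝ → ℝ} (hF : Continuous (Function.uncurry F)) {ε : ℝ} (hε : 0 < ε) :
    ∃ δ > 0, ∀ s ∈ Icc (0 : ℝ) T, ∀ t ∈ Icc (0 : ℝ) T, |s - t| < δ →
      ∀ c ∈ uIcc (x s) (x t), |F s c - F s (x s)| ≤ ε := by
  obtain ⟨R, hR⟩ := isCompact_Icc.exists_bound_of_continuousOn hx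
  have hK : IsCompact (Icc (0 : ℝ) T ×ˢ Icc (-R) R) := isCompact_Icc.prod isCompact_Icc
  obtain ⟨η, hη, hmod⟩ := Metric.uniformContinuousOn_iff.1
    (hK.uniformContinuousOn_of_continuous hF.continuousOn) ε hε
  obtain ⟨δ, hδ, hxmod⟩ := Metric.uniformContinuousOn_iff.1
    (isCompact_Icc.uniformContinuousOn_of_continuous hx) η hη
  refine ⟨δ, hδ, fun s hs t ht hst c hc => ?_⟩
  have hxs : x s ∈ Icc (-R) R := abs_le.1 (hR s hs)
  have hxt : x t ∈ Icc (-R) R := abs_le.1 (hR t ht)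
  have hcs : |c - x s| < η := by
    refine (abs_sub_left_of_mem_uIcc hc).trans_lt ?_
    rw [abs_sub_comm]
    exact hxmod s hs t ht hst
  have := hmod (s, c) ⟨hs, uIcc_subset_Icc hxs hxt hc⟩ (s, x s) ⟨hs, hxs⟩
    (by rw [dist_prod_same_left]; exact hcs)
  exact this.le

theorem tendsto_zero_of_abs_le_mul {u v : ℕ → ℝ} {c : ℝ} (hv : Tendsto v atTop (nhds c))
    (h : ∀ ε > 0, ∀ᶠ n in atTop, |u n| ≤ ε * |v n|) : Tendsto u atTop (nhds 0) := by
  have huv : u =o[atTop] v := Asymptotics.isLittleO_iff.2 fun ε hε => h ε hε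
  exact (Asymptotics.isLittleO_one_iff ℝ).1 (huv.trans_isBigO (hv.isBigO_one ℝ))

namespace PartitionSeq

variable {T : ℝ} (P : PartitionSeq T)

/-- The increments of `f` in time, with the path frozen at the right endpoint, sum up to the
integral of the time derivative along the path. -/
theorem tendsto_sum_time_increment {x : ℝ → ℝ} (hx : ContinuousOn x (Icc 0 T))
    {f ft : ℝ → ℝ → ℝ} (hft : ∀ t a : ℝ, HasDerivAt (fun u => f u a) (ft t a) t)
    (hft_cont : Continuous (Function.uncurry ft)) :
    Tendsto (fun n => ∑ j ∈ Finset.range (P.k n),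
      (f (P.τ n (j + 1)) (x (P.τ n (j + 1))) - f (P.τ n j) (x (P.τ n (j + 1))))) atTop
      (nhds (∫ s in (0 : ℝ)..T, ft s (x s))) := by
  rw [← tendsto_sub_nhds_zero_iff]
  refine tendsto_zero_of_abs_le_mul (v := fun _ => T) tendsto_const_nhds fun ε hε => ?_
  obtain ⟨δ, hδ, hmod⟩ := exists_modulus_along_path hx hft_cont hε
  filter_upwards [P.eventually_abs_sub_lt hδ] with n hn
  have hle : ∀ j < P.k n, P.τ n j ≤ P.τ n (j + 1) := fun j hj => P.le_of_le (Nat.le_succ j) hj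
  have hsub : ∀ j < P.k n, Icc (P.τ n j) (P.τ n (j + 1)) ⊆ Icc 0 T := fun j hj =>
    Icc_subset_Icc (P.mem_Icc hj.le).1 (P.mem_Icc hj).2
  have hcont : ContinuousOn (fun s => ft s (x s)) (Icc 0 T) :=
    hft_cont.comp_continuousOn (continuousOn_id.prodMk hx)
  have hint : ∀ j < P.k n,
      IntervalIntegrable (fun s => ft s (x s)) volume (P.τ n j) (P.τ n (j + 1)) := fun j hj =>
    (hcont.mono (hsub j hj)).intervalIntegrable_of_Icc (hle j hj)
  have hsum := intervalIntegral.sum_integral_adjacent_intervals hint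
  rw [P.first, P.last] at hsum
  have htel : |T| = ∑ j ∈ Finset.range (P.k n), (P.τ n (j + 1) - P.τ n j) := by
    rw [Finset.sum_range_sub (fun j => P.τ n j), P.last, P.first, sub_zero,
      abs_of_nonneg (P.last n ▸ (P.mem_Icc (n := n) le_rfl).1)]
  rw [← hsum, ← Finset.sum_sub_distrib, htel, Finset.mul_sum]
  refine (Finset.abs_sum_le_sum_abs _ _).trans (Finset.sum_le_sum fun j hj => ?_)
  have hj := Finset.mem_range.1 hj
  have hfix : Continuous fun s => ft s (x (P.τ n (j + 1))) :=
    hft_cont.comp (continuous_id.prodMk continuous_const)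
  have hfix_int := hfix.intervalIntegrable (μ := volume) (P.τ n j) (P.τ n (j + 1))
  rw [← intervalIntegral.integral_eq_sub_of_hasDerivAt
      (fun s _ => hft s (x (P.τ n (j + 1)))) hfix_int,
    ← intervalIntegral.integral_sub hfix_int (hint j hj),
    ← abs_of_nonneg (sub_nonneg.2 (hle j hj))]
  refine (Real.norm_eq_abs _).ge.trans
    (intervalIntegral.norm_integral_le_of_norm_le_const fun s hs => ?_)
  rw [uIoc_of_le (hle j hj)] at hs
  have hs := Ioc_subset_Icc_self hs
  exact hmod s (hsub j hj hs) _ (P.mem_Icc hj)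
    (hn j hj s hs _ (right_mem_Icc.2 (hle j hj))) _ right_mem_uIcc

theorem quadSum_eq (x : ℝ → ℝ) (n : ℕ) : quadSum (P.k n) (P.τ n) x T =
    ∑ j ∈ Finset.range (P.k n), (x (P.τ n (j + 1)) - x (P.τ n j)) ^ 2 :=
  Finset.sum_congr rfl fun _ hj => if_pos (P.mem_Icc (Finset.mem_range.1 hj)).2

theorem fwdSum_eq (y x : ℝ → ℝ) (n : ℕ) : fwdSum (P.k n) (P.τ n) y x T =
    ∑ j ∈ Finset.range (P.k n), y (P.τ n j) * (x (P.τ n (j + 1)) - x (P.τ n j)) :=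
  Finset.sum_congr rfl fun _ hj => if_pos (P.mem_Icc (Finset.mem_range.1 hj)).2

/-- The second-order Taylor remainders in the space variable sum up to zero in the limit. -/
theorem tendsto_sum_taylor_remainder {x : ℝ → ℝ} (hx : ContinuousOn x (Icc 0 T)) {c : ℝ}
    (hqv : Tendsto (fun n => quadSum (P.k n) (P.τ n) x T) atTop (nhds c))
    {f fx fxx : ℝ → ℝ → ℝ}
    (hfx : ∀ t a : ℝ, HasDerivAt (fun b => f t b) (fx t a) a)
    (hfxx : ∀ t a : ℝ, HasDerivAt (fun b => fx t b) (fxx t a) a)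
    (hfxx_cont : Continuous (Function.uncurry fxx)) :
    Tendsto (fun n => ∑ j ∈ Finset.range (P.k n),
      (f (P.τ n j) (x (P.τ n (j + 1))) - f (P.τ n j) (x (P.τ n j))
        - fx (P.τ n j) (x (P.τ n j)) * (x (P.τ n (j + 1)) - x (P.τ n j))
        - 1 / 2 * (fxx (P.τ n j) (x (P.τ n j)) * (x (P.τ n (j + 1)) - x (P.τ n j)) ^ 2)))
      atTop (nhds 0) := by
  refine tendsto_zero_of_abs_le_mul hqv fun ε hε => ?_
  obtain ⟨δ, hδ, hmod⟩ := exists_modulus_along_path hx hfxx_cont hε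
  filter_upwards [P.eventually_abs_sub_lt hδ] with n hn
  have hnonneg := Finset.sum_nonneg fun j (_ : j ∈ Finset.range (P.k n)) =>
    sq_nonneg (x (P.τ n (j + 1)) - x (P.τ n j))
  rw [P.quadSum_eq, abs_of_nonneg hnonneg, Finset.mul_sum]
  refine (Finset.abs_sum_le_sum_abs _ _).trans (Finset.sum_le_sum fun j hj => ?_)
  have hj := Finset.mem_range.1 hj
  have hle : P.τ n j ≤ P.τ n (j + 1) := P.le_of_le (Nat.le_succ j) hj
  exact abs_taylor_two_sub_le (hfx _) (hfxx _) (hmod _ (P.mem_Icc hj.le) _ (P.mem_Icc hj)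
    (hn j hj _ (left_mem_Icc.2 hle) _ (right_mem_Icc.2 hle)))

end PartitionSeq

/-- Föllmer's pathwise change of variables formula: if the continuous path `x`
has quadratic variation `q` along the partition sequence `P` (with `μq` the
Lebesgue–Stieltjes measure of `q`), and `f : [0,T] × ℝ → ℝ` is `C^{1,2}` with
jointly continuous partial derivatives `ft = ∂_t f`, `fx = ∂_x f`,
`fxx = ∂²_{xx} f`, then the Föllmer integral
`I = lim_n Σ fx (t_{j-1}ⁿ, x (t_{j-1}ⁿ)) (x (t_jⁿ) - x (t_{j-1}ⁿ))` exists and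
`f T (x T) = f 0 (x 0) + ∫₀^T ft s (x s) ds + (1/2) ∫_{(0,T]} fxx s (x s) dμq + I`. -/
theorem follmer_change_of_variables
    (T : ℝ) (hT : 0 < T) (P : PartitionSeq T)
    (x : ℝ → ℝ) (hx : ContinuousOn x (Set.Icc 0 T))
    (q : ℝ → ℝ) (hq_cont : Continuous q) (hq_mono : Monotone q) (hq0 : q 0 = 0)
    (hqv : ∀ t ∈ Set.Icc (0 : ℝ) T,
      Tendsto (fun n => quadSum (P.k n) (P.τ n) x t) atTop (nhds (q t)))
    (μq : Measure ℝ)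
    (hμq : ∀ a b : ℝ, a ≤ b → μq (Set.Ioc a b) = ENNReal.ofReal (q b - q a))
    (f ft fx fxx : ℝ → ℝ → ℝ)
    (hft : ∀ t a : ℝ, HasDerivAt (fun u => f u a) (ft t a) t)
    (hfx : ∀ t a : ℝ, HasDerivAt (fun b => f t b) (fx t a) a)
    (hfxx : ∀ t a : ℝ, HasDerivAt (fun b => fx t b) (fxx t a) a)
    (hft_cont : Continuous (Function.uncurry ft))
    (hfx_cont : Continuous (Function.uncurry fx))
    (hfxx_cont : Continuous (Function.uncurry fxx)) :
    ∃ I : ℝ,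
      Tendsto (fun n => fwdSum (P.k n) (P.τ n) (fun s => fx s (x s)) x T) atTop (nhds I) ∧
      f T (x T) = f 0 (x 0) + (∫ s in (0 : ℝ)..T, ft s (x s))
        + (1 / 2) * (∫ s in Set.Ioc (0 : ℝ) T, fxx s (x s) ∂μq) + I := by
  have : IsLocallyFiniteMeasure μq := ⟨fun t => ⟨Ioc (t - 1) (t + 1),
    Ioc_mem_nhds (by linarith) (by linarith), by
      rw [hμq _ _ (by linarith)]; exact ENNReal.ofReal_lt_top⟩⟩
  have hquad := P.tendsto_sum_mul_weight
    (w := fun n j => (x (P.τ n (j + 1)) - x (P.τ n j)) ^ 2) (fun _ _ => sq_nonneg _) hq_mono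
    hqv hμq (g := fun s => fxx s (x s))
    (hfxx_cont.comp_continuousOn (continuousOn_id.prodMk hx))
  have htime := P.tendsto_sum_time_increment hx hft hft_cont
  have htaylor := P.tendsto_sum_taylor_remainder hx (hqv T (right_mem_Icc.2 hT.le)) hfx hfxx
    hfxx_cont
  have hlim := (((tendsto_const_nhds (x := f T (x T) - f 0 (x 0))).sub htime).sub
    htaylor).sub (hquad.const_mul (1 / 2))
  refine ⟨_, hlim.congr fun n => ?_, by ring⟩
  have htel := Finset.sum_range_sub (fun j => f (P.τ n j) (x (P.τ n j))) (P.k n)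
  simp only [P.last, P.first] at htel
  rw [P.fwdSum_eq, ← htel, Finset.mul_sum, ← Finset.sum_sub_distrib, ← Finset.sum_sub_distrib,
    ← Finset.sum_sub_distrib]
  exact Finset.sum_congr rfl fun j _ => by ring
end

section
/- Let T > 0, let (πₙ) be a sequence of partitions of [0,T] with mesh |πₙ| → 0, let x : [0,T] → ℝ be a continuous path having quadratic variation q along (πₙ), and let f : ℝ → ℝ be continuously differentiable. Then the composed path f ∘ x has quadratic variation along (πₙ) given by t ↦ ∫_{(0,t]} f′(x(s))² dμ_q(s); that is, for every t ∈ [0,T], Σ_{t_j^n ∈ πₙ ∩ (0,t]} (f(x(t_j^n)) − f(x(t_{j−1}^n)))² → ∫_{(0,t]} f′(x(s))² dμ_q(s) as n → ∞. -/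
open Filter MeasureTheory Set

namespace PartitionSeq

variable {T : ℝ} (P : PartitionSeq T) {n j : ℕ}

lemma lt_succ (hj : j < P.k n) : P.τ n j < P.τ n (j + 1) :=
  P.mono n (mem_Iic.2 hj.le) (mem_Iic.2 hj) j.lt_succ_self

lemma nonneg (hj : j ≤ P.k n) : 0 ≤ P.τ n j := by
  rw [← P.first n]
  exact (P.mono n).monotoneOn (mem_Iic.2 (Nat.zero_le _)) (mem_Iic.2 hj) (Nat.zero_le _)

lemma le_last (hj : j ≤ P.k n) : P.τ n j ≤ T :=
  ((P.mono n).monotoneOn (mem_Iic.2 hj) (mem_Iic.2 le_rfl) hj).trans_eq (P.last n)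

lemma quadSum_zero (y : ℝ → ℝ) : quadSum (P.k n) (P.τ n) y 0 = 0 := by
  refine Finset.sum_eq_zero fun j hj => if_neg (not_le.2 ?_)
  have hj := Finset.mem_range.1 hj
  exact (P.nonneg hj.le).trans_lt (P.lt_succ hj)

end PartitionSeq

/-- The mean value theorem, without an order assumption on the end points. -/
lemma exists_uIcc_sub_eq_deriv_mul {f : ℝ → ℝ} (hf : Differentiable ℝ f) (u v : ℝ) :
    ∃ ξ ∈ uIcc u v, f v - f u = deriv f ξ * (v - u) := by
  wlog huv : u ≤ v generalizing u v
  · obtain ⟨ξ, hξ, h⟩ := this v u (le_of_not_ge huv)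
    exact ⟨ξ, uIcc_comm u v ▸ hξ, by linarith⟩
  rcases huv.eq_or_lt with rfl | huv
  · exact ⟨u, left_mem_uIcc, by simp⟩
  obtain ⟨ξ, hξ, h⟩ :=
    exists_deriv_eq_slope f huv hf.continuous.continuousOn hf.differentiableOn
  refine ⟨ξ, Icc_subset_uIcc (Ioo_subset_Icc_self hξ), ?_⟩
  rw [h, div_mul_cancel₀ _ (sub_ne_zero.2 huv.ne')]

/-- The squared increment of `f ∘ x` over an interval is the squared increment of `x` times the
value of `(f' ∘ x) ^ 2` at some point of the interval. -/
lemma exists_sq_sub_comp_eq {f x : ℝ → ℝ} (hf : Differentiable ℝ f) {a b : ℝ} (hab : a ≤ b)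
    (hx : ContinuousOn x (Icc a b)) :
    ∃ s ∈ Icc a b, (f (x b) - f (x a)) ^ 2 = deriv f (x s) ^ 2 * (x b - x a) ^ 2 := by
  obtain ⟨ξ, hξ, h⟩ := exists_uIcc_sub_eq_deriv_mul hf (x a) (x b)
  obtain ⟨s, hs, rfl⟩ := intermediate_value_uIcc (by rwa [uIcc_of_le hab]) hξ
  exact ⟨s, by rwa [uIcc_of_le hab] at hs, by rw [h, mul_pow]⟩

/-- If `(f' ∘ x) ^ 2` is within `ε` of `c` near `(a, b]`, at the scale of the partition, then the
quadratic variation sum of `f ∘ x` over `(a, b]` is close to `c` times that of `x`. -/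
lemma abs_quadSum_comp_sub_le {k : ℕ} {x f : ℝ → ℝ} {τ : ℕ → ℝ} (hf : Differentiable ℝ f)
    (hτ : ∀ j < k, τ j ≤ τ (j + 1)) (hx : ∀ j < k, ContinuousOn x (Icc (τ j) (τ (j + 1))))
    {a b c ε : ℝ} (hab : a ≤ b)
    (hc : ∀ j < k, τ (j + 1) ∈ Ioc a b → ∀ s ∈ Icc (τ j) (τ (j + 1)),
      |deriv f (x s) ^ 2 - c| ≤ ε) :
    |(quadSum k τ (f ∘ x) b - quadSum k τ (f ∘ x) a) - c * (quadSum k τ x b - quadSum k τ x a)| ≤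
      ε * (quadSum k τ x b - quadSum k τ x a) := by
  simp only [quadSum, ← Finset.sum_sub_distrib, Finset.mul_sum]
  refine (Finset.abs_sum_le_sum_abs _ _).trans (Finset.sum_le_sum fun j hj => ?_)
  have hj := Finset.mem_range.1 hj
  by_cases ha : τ (j + 1) ≤ a
  · simp [ha, ha.trans hab]
  by_cases hb : τ (j + 1) ≤ b
  · obtain ⟨s, hs, h⟩ := exists_sq_sub_comp_eq hf (hτ j hj) (hx j hj)
    simp only [if_pos hb, if_neg ha, sub_zero, Function.comp_apply, h, ← sub_mul, abs_mul, abs_sq]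
    exact mul_le_mul_of_nonneg_right (hc j hj ⟨not_le.1 ha, hb⟩ s hs) (sq_nonneg _)
  · simp [ha, hb]

/-- A measure giving finite mass to bounded half-open intervals is locally finite. -/
lemma isLocallyFiniteMeasure_of_Ioc_lt_top {μ : Measure ℝ}
    (h : ∀ a b : ℝ, a ≤ b → μ (Ioc a b) < ⊤) : IsLocallyFiniteMeasure μ :=
  ⟨fun x => ⟨Ioc (x - 1) (x + 1), Ioc_mem_nhds (by linarith) (by linarith),
    h _ _ (by linarith)⟩⟩

/-- Replacing the integrand by a constant within `ε` of it changes the integral by at most `ε`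
times the mass. -/
lemma abs_setIntegral_sub_const_mul_le {α : Type*} [MeasurableSpace α] {μ : Measure α} {s : Set α}
    {g : α → ℝ} {c ε : ℝ} (hs : μ s < ⊤) (hg : IntegrableOn g s μ)
    (h : ∀ x ∈ s, |g x - c| ≤ ε) :
    |∫ x in s, g x ∂μ - c * μ.real s| ≤ ε * μ.real s := by
  have hc : IntegrableOn (fun _ : α => c) s μ := integrableOn_const hs.ne
  have := norm_setIntegral_le_of_norm_le_const (f := fun x => g x - c) hs h
  rwa [integral_sub hg hc, setIntegral_const, smul_eq_mul, mul_comm _ c] at this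

/-- Quadratic variation of a `C¹` image: if the continuous path `x` has
quadratic variation `q` along the partition sequence `P` (with `μq` the
Lebesgue–Stieltjes measure of `q`) and `f` is continuously differentiable,
then `f ∘ x` has quadratic variation `t ↦ ∫_{(0,t]} f' (x s) ^ 2 dμq` along
`P`. -/
theorem quadratic_variation_comp_C1
    (T : ℝ) (hT : 0 < T) (P : PartitionSeq T)
    (x : ℝ → ℝ) (hx : ContinuousOn x (Set.Icc 0 T))
    (q : ℝ → ℝ) (hq_cont : Continuous q) (hq_mono : Monotone q) (hq0 : q 0 = 0)
    (hqv : ∀ t ∈ Set.Icc (0 : ℝ) T,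
      Tendsto (fun n => quadSum (P.k n) (P.τ n) x t) atTop (nhds (q t)))
    (μq : Measure ℝ)
    (hμq : ∀ a b : ℝ, a ≤ b → μq (Set.Ioc a b) = ENNReal.ofReal (q b - q a))
    (f : ℝ → ℝ) (hf : ContDiff ℝ 1 f)
    (t : ℝ) (ht : t ∈ Set.Icc 0 T) :
    Tendsto (fun n => quadSum (P.k n) (P.τ n) (f ∘ x) t) atTop
      (nhds (∫ s in Set.Ioc (0 : ℝ) t, (deriv f (x s)) ^ 2 ∂μq)) := by
  have hμ_top : ∀ a b : ℝ, a ≤ b → μq (Ioc a b) < ⊤ := fun a b hab => by simp [hμq a b hab]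
  have hμ_real : ∀ a b : ℝ, a ≤ b → μq.real (Ioc a b) = q b - q a := fun a b hab => by
    rw [measureReal_def, hμq a b hab, ENNReal.toReal_ofReal (sub_nonneg.2 (hq_mono hab))]
  have := isLocallyFiniteMeasure_of_Ioc_lt_top hμ_top
  have hfd : Differentiable ℝ f := hf.differentiable one_ne_zero
  set g : ℝ → ℝ := fun s => deriv f (x s) ^ 2
  have hg : ContinuousOn g (Icc 0 T) :=
    ((hf.continuous_deriv le_rfl).comp_continuousOn hx).pow 2
  have hg_int : ∀ a b : ℝ, 0 ≤ a → b ≤ T → IntegrableOn g (Ioc a b) μq := fun a b ha hb =>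
    hg.integrableOn_Icc.mono_set fun s hs => ⟨ha.trans hs.1.le, hs.2.trans hb⟩
  have hg_unif := isCompact_Icc.uniformContinuousOn_of_continuous hg
  have h_approx : ∀ ε > 0, ∀ η > 0, ∀ᶠ n in atTop,
      |quadSum (P.k n) (P.τ n) (f ∘ x) t - ∫ s in Ioc 0 t, g s ∂μq| ≤ 2 * ε * q t + η := by
    intro ε hε
    obtain ⟨δ, hδ, hgδ⟩ := Metric.uniformContinuousOn_iff_le.1 hg_unif ε hε
    have h_step : ∀ a b : ℝ, 0 ≤ a → a ≤ b → b ≤ T → b - a ≤ δ / 2 →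
        (∀ η > 0, ∀ᶠ n in atTop,
          |quadSum (P.k n) (P.τ n) (f ∘ x) a - ∫ s in Ioc 0 a, g s ∂μq| ≤ 2 * ε * q a + η) →
        ∀ η > 0, ∀ᶠ n in atTop,
          |quadSum (P.k n) (P.τ n) (f ∘ x) b - ∫ s in Ioc 0 b, g s ∂μq| ≤ 2 * ε * q b + η := by
      intro a b ha hab hb hδab ih η hη
      have hgb : ∀ s ∈ Icc 0 T, |s - b| ≤ δ → |g s - g b| ≤ ε := fun s hs hsb =>
        hgδ s hs b ⟨ha.trans hab, hb⟩ hsb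
      have h_int : |∫ s in Ioc a b, g s ∂μq - g b * (q b - q a)| ≤ ε * (q b - q a) := by
        rw [← hμ_real a b hab]
        refine abs_setIntegral_sub_const_mul_le (hμ_top a b hab) (hg_int a b ha hb) fun s hs => ?_
        refine hgb s ⟨ha.trans hs.1.le, hs.2.trans hb⟩ (abs_le.2 ⟨?_, ?_⟩) <;>
          linarith [hs.1, hs.2]
      have h_add : ∫ s in Ioc 0 b, g s ∂μq =
          ∫ s in Ioc 0 a, g s ∂μq + ∫ s in Ioc a b, g s ∂μq := by
        rw [← Ioc_union_Ioc_eq_Ioc ha hab]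
        exact setIntegral_union (Ioc_disjoint_Ioc_of_le le_rfl) measurableSet_Ioc
          (hg_int 0 a le_rfl (hab.trans hb)) (hg_int a b ha hb)
      have h_lim : Tendsto (fun n => (ε + |g b|) *
          |quadSum (P.k n) (P.τ n) x b - quadSum (P.k n) (P.τ n) x a - (q b - q a)|)
          atTop (nhds 0) := by
        have h := (hqv b ⟨ha.trans hab, hb⟩).sub (hqv a ⟨ha, hab.trans hb⟩)
        simpa using ((h.sub_const (q b - q a)).abs.const_mul (ε + |g b|))
      obtain ⟨N, hN⟩ := P.mesh (δ / 2) (by positivity)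
      filter_upwards [ih (η / 2) (by positivity), eventually_ge_atTop N,
        h_lim.eventually_le_const (show 0 < η / 2 by positivity)] with n hn hnN hn_lim
      have h_sum := abs_quadSum_comp_sub_le (x := x) (c := g b) (ε := ε) hfd
        (fun j hj => (P.lt_succ hj).le)
        (fun j hj => hx.mono (Icc_subset_Icc (P.nonneg hj.le) (P.le_last hj))) hab
        (fun j hj hjab s hs => hgb s ⟨(P.nonneg hj.le).trans hs.1, hs.2.trans (P.le_last hj)⟩ <| by
          have := hN n hnN j hj
          rw [abs_le]
          constructor <;> linarith [hs.1, hs.2, hjab.1, hjab.2])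
      set Δ := quadSum (P.k n) (P.τ n) x b - quadSum (P.k n) (P.τ n) x a
      have h_eps : ε * (Δ - (q b - q a)) ≤ ε * |Δ - (q b - q a)| :=
        mul_le_mul_of_nonneg_left (le_abs_self _) hε.le
      have h_gb := abs_le.1 (abs_mul (g b) (Δ - (q b - q a))).le
      rw [h_add]
      rw [abs_le] at hn h_int h_sum ⊢
      constructor <;> linarith [hn.1, hn.2, h_int.1, h_int.2, h_sum.1, h_sum.2, h_gb.1, h_gb.2]
    obtain ⟨m, hm⟩ := exists_nat_gt (t / (δ / 2))
    have hm_pos : (0 : ℝ) < m := (div_nonneg ht.1 (by positivity)).trans_lt hm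
    have h_grid : ∀ i ≤ m, ∀ η > 0, ∀ᶠ n in atTop,
        |quadSum (P.k n) (P.τ n) (f ∘ x) (i * (t / m)) - ∫ s in Ioc 0 (i * (t / m)), g s ∂μq| ≤
          2 * ε * q (i * (t / m)) + η := by
      have htm : 0 ≤ t / m := div_nonneg ht.1 hm_pos.le
      intro i
      induction i with
      | zero =>
        intro _ η hη
        simp [P.quadSum_zero, hq0, hη.le]
      | succ i ih =>
        intro hi
        refine h_step (i * (t / m)) _ (by positivity) ?_ ?_ ?_ (ih (by omega))
        · push_cast; linarith
        · calc ((i + 1 : ℕ) : ℝ) * (t / m) ≤ m * (t / m) := by gcongr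
            _ = t := mul_div_cancel₀ t hm_pos.ne'
            _ ≤ T := ht.2
        · rw [div_lt_iff₀ (by positivity), mul_comm, ← div_lt_iff₀ hm_pos] at hm
          push_cast
          linarith
    simpa [mul_div_cancel₀ t hm_pos.ne'] using h_grid m le_rfl
  rw [Metric.tendsto_nhds]
  intro r hr
  have hqt : 0 ≤ q t := hq0 ▸ hq_mono ht.1
  have h_small : 2 * (r / (4 * (q t + 1))) * q t ≤ r / 2 := by
    rw [show 2 * (r / (4 * (q t + 1))) * q t = r / 2 * (q t / (q t + 1)) by field_simp; ring]
    exact mul_le_of_le_one_right (by positivity) ((div_le_one (by positivity)).2 (by linarith))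
  filter_upwards [h_approx (r / (4 * (q t + 1))) (by positivity) (r / 4) (by positivity)] with n hn
  rw [Real.dist_eq]
  linarith
end
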